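/- Let α > 0, r* ∈ (−3/2, ∞), and let ū, u : (0,∞) → H¹(ℝ³;ℝ³) satisfy the decay bounds ‖ū(t)‖²_{H¹_α} ≤ C (C′ + t)^{−(3/2 + r*)} and ‖u(t)‖²_{H¹_α} ≤ C (C′ + t)^{−min{3/2 + r*, 5/2}} for all t > 0 and some C, C′ > 0, where ‖v‖²_{H¹_α} = ‖v‖²_{L²} + α²‖∇v‖²_{L²}. Then there exist constants C₁, C₂ > 0 such that for all t > 0, | ∫_{ℝ³} Σ_{i,j=1}^{3} (∂_i ū_j)(x,t) u_i(x,t) u_j(x,t) dx | ≤ C₁ (C₂ + t)^{−min{9/4 + (3/2)r*, 13/4 + (1/2)r*}}. -/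

import Mathlib

open MeasureTheory Filter Topology Metric
open scoped ENNReal

theorem sq_lintegral_mul_le {X : Type*} [MeasurableSpace X] (μ : Measure X) {f g : X → ℝ≥0∞}
    (hf : AEMeasurable f μ) (hg : AEMeasurable g μ) :
    (∫⁻ x, f x * g x ∂μ) ^ 2 ≤ (∫⁻ x, f x ^ 2 ∂μ) * ∫⁻ x, g x ^ 2 ∂μ := by
  have h := ENNReal.lintegral_mul_le_Lp_mul_Lq μ Real.HolderConjugate.two_two hf hg
  simp only [Pi.mul_apply, ENNReal.rpow_two] at h
  refine (pow_le_pow_left' h 2).trans_eq ?_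
  rw [mul_pow, ← ENNReal.rpow_mul_natCast, ← ENNReal.rpow_mul_natCast]
  norm_num

/-- Ladyzhenskaya's slicing argument: a bound on `a ^ 2` by the integral of `a * b` along every line
parallel to a coordinate axis of `ℝ³` controls the integral of `a ^ 4`. -/
theorem lintegral_pow_four_le_of_sq_le_lintegral_line {a b : ℝ × ℝ × ℝ → ℝ≥0∞}
    (ha : Measurable a) (hb : Measurable b)
    (h₀ : ∀ z x y, a (z, x, y) ^ 2 ≤ ∫⁻ s, a (s, x, y) * b (s, x, y))
    (h₁ : ∀ z x y, a (z, x, y) ^ 2 ≤ ∫⁻ s, a (z, s, y) * b (z, s, y))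
    (h₂ : ∀ z x y, a (z, x, y) ^ 2 ≤ ∫⁻ s, a (z, x, s) * b (z, x, s)) :
    ∫⁻ p, a p ^ 4 ≤ (∫⁻ p, a p * b p) * ∫⁻ p, b p ^ 2 := by
  have hab : Measurable fun p => a p * b p := ha.mul hb
  have slice (z : ℝ) : ∫⁻ q : ℝ × ℝ, a (z, q) ^ 4 ≤ (∫⁻ q : ℝ × ℝ, a (z, q) * b (z, q)) ^ 2 := by
    calc ∫⁻ q : ℝ × ℝ, a (z, q) ^ 4
        ≤ ∫⁻ q : ℝ × ℝ, (∫⁻ s, a (z, q.1, s) * b (z, q.1, s)) *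
            ∫⁻ s, a (z, s, q.2) * b (z, s, q.2) := by
          refine lintegral_mono fun q => ?_
          calc a (z, q) ^ 4 = a (z, q.1, q.2) ^ 2 * a (z, q.1, q.2) ^ 2 := by ring
            _ ≤ _ := mul_le_mul' (h₂ z q.1 q.2) (h₁ z q.1 q.2)
      _ = (∫⁻ x, ∫⁻ s, a (z, x, s) * b (z, x, s)) * ∫⁻ y, ∫⁻ s, a (z, s, y) * b (z, s, y) := by
          rw [Measure.volume_eq_prod]
          refine lintegral_prod_mul (f := fun x => ∫⁻ s, a (z, x, s) * b (z, x, s))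
            (g := fun y => ∫⁻ s, a (z, s, y) * b (z, s, y)) ?_ ?_
          · exact (Measurable.lintegral_prod_right' (f := fun q : ℝ × ℝ => a (z, q) * b (z, q))
              (by fun_prop)).aemeasurable
          · exact (Measurable.lintegral_prod_left' (f := fun q : ℝ × ℝ => a (z, q) * b (z, q))
              (by fun_prop)).aemeasurable
      _ = (∫⁻ q : ℝ × ℝ, a (z, q) * b (z, q)) ^ 2 := by
          rw [Measure.volume_eq_prod, sq, lintegral_prod _ (by fun_prop)]
          congr 1
          exact lintegral_lintegral_swap (f := fun y x => a (z, x, y) * b (z, x, y)) (by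
            unfold Function.uncurry; fun_prop)
  have slice_sq (z : ℝ) : ∫⁻ q : ℝ × ℝ, a (z, q) ^ 2 ≤ ∫⁻ p, a p * b p := by
    rw [Measure.volume_eq_prod ℝ (ℝ × ℝ), lintegral_prod_symm _ hab.aemeasurable]
    exact lintegral_mono fun q => h₀ z q.1 q.2
  calc ∫⁻ p, a p ^ 4 = ∫⁻ z, ∫⁻ q : ℝ × ℝ, a (z, q) ^ 4 := by
        rw [Measure.volume_eq_prod ℝ (ℝ × ℝ), lintegral_prod _ (by fun_prop)]
    _ ≤ ∫⁻ z, (∫⁻ p, a p * b p) * ∫⁻ q : ℝ × ℝ, b (z, q) ^ 2 := by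
        refine lintegral_mono fun z => (slice z).trans ?_
        refine (sq_lintegral_mul_le _ (by fun_prop) (by fun_prop)).trans ?_
        gcongr
        exact slice_sq z
    _ = (∫⁻ p, a p * b p) * ∫⁻ p, b p ^ 2 := by
        rw [lintegral_const_mul _ (Measurable.lintegral_prod_right'
            (f := fun p : ℝ × ℝ × ℝ => b p ^ 2) (by fun_prop)), Measure.volume_eq_prod ℝ (ℝ × ℝ), lintegral_prod (fun p => b p ^ 2) (by fun_prop)]

theorem enorm_sq_le_lintegral_enorm_deriv {F : Type*} [NormedAddCommGroup F]
    [InnerProductSpace ℝ F] [FiniteDimensional ℝ F] {w : ℝ → F} (hw : Differentiable ℝ w) (x : ℝ) :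
    ‖w x‖ₑ ^ 2 ≤ ∫⁻ s, ‖w s‖ₑ * (‖w s‖ₑ + 2 * ‖deriv w s‖ₑ) := by
  by_cases htop : ∫⁻ s, ‖w s‖ₑ * (‖w s‖ₑ + 2 * ‖deriv w s‖ₑ) = ∞
  · simp [htop]
  borelize F
  have hder (s : ℝ) : HasDerivAt (fun s => ‖w s‖ ^ 2) (2 * inner ℝ (w s) (deriv w s)) s :=
    (hw s).hasDerivAt.norm_sq
  have hwc : Continuous w := hw.continuous
  have hbound (s : ℝ) : ‖2 * inner ℝ (w s) (deriv w s)‖ₑ ≤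
      ‖w s‖ₑ * (‖w s‖ₑ + 2 * ‖deriv w s‖ₑ) := by
    calc ‖2 * inner ℝ (w s) (deriv w s)‖ₑ ≤ 2 * (‖w s‖ₑ * ‖deriv w s‖ₑ) := by
          rw [enorm_mul]
          gcongr
          · simp [Real.enorm_eq_ofReal_abs]
          · rw [← ofReal_norm, ← ofReal_norm, ← ofReal_norm, ← ENNReal.ofReal_mul (norm_nonneg _)]
            exact ENNReal.ofReal_le_ofReal (norm_inner_le_norm _ _)
      _ = ‖w s‖ₑ * (2 * ‖deriv w s‖ₑ) := by ring
      _ ≤ _ := by gcongr; exact le_add_self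
  have hint : Integrable (fun s => ‖w s‖ ^ 2) := by
    refine ⟨by fun_prop, lt_of_le_of_lt (lintegral_mono fun s => ?_) (lt_top_iff_ne_top.2 htop)⟩
    rw [enorm_pow, enorm_norm, sq]
    gcongr
    exact le_self_add
  have hmeas : Measurable (deriv w) := measurable_deriv w
  have hint' : Integrable (fun s => 2 * inner ℝ (w s) (deriv w s)) :=
    ⟨by fun_prop, lt_of_le_of_lt (lintegral_mono hbound) (lt_top_iff_ne_top.2 htop)⟩
  have hlim : Tendsto (fun s => ‖w s‖ ^ 2) atBot (𝓝 0) :=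
    tendsto_zero_of_hasDerivAt_of_integrableOn_Iic (a := x) (fun s _ => hder s)
      hint'.integrableOn hint.integrableOn
  have hftc := integral_Iic_of_hasDerivAt_of_tendsto' (a := x) (fun s _ => hder s)
    hint'.integrableOn hlim
  rw [sub_zero] at hftc
  calc ‖w x‖ₑ ^ 2 = ‖‖w x‖ ^ 2‖ₑ := by rw [enorm_pow, enorm_norm]
    _ ≤ ∫⁻ s in Set.Iic x, ‖2 * inner ℝ (w s) (deriv w s)‖ₑ := by
        rw [← hftc]; exact MeasureTheory.enorm_integral_le_lintegral_enorm _
    _ ≤ ∫⁻ s, ‖2 * inner ℝ (w s) (deriv w s)‖ₑ := setLIntegral_le_lintegral _ _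
    _ ≤ _ := lintegral_mono hbound

theorem enorm_sq_le_lintegral_line {E F : Type*} [NormedAddCommGroup E] [NormedSpace ℝ E]
    [NormedAddCommGroup F] [InnerProductSpace ℝ F] [FiniteDimensional ℝ F] {u : E → F}
    (hu : Differentiable ℝ u) {γ : ℝ → E} {v : E} (hv : ‖v‖ ≤ 1)
    (hγ : ∀ s, HasDerivAt γ v s) (x : ℝ) :
    ‖u (γ x)‖ₑ ^ 2 ≤ ∫⁻ s, ‖u (γ s)‖ₑ * (‖u (γ s)‖ₑ + 2 * ‖fderiv ℝ u (γ s)‖ₑ) := by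
  have hder (s : ℝ) : HasDerivAt (u ∘ γ) (fderiv ℝ u (γ s) v) s :=
    (hu (γ s)).hasFDerivAt.comp_hasDerivAt s (hγ s)
  refine (enorm_sq_le_lintegral_enorm_deriv (fun s => (hder s).differentiableAt) x).trans
    (lintegral_mono fun s => ?_)
  rw [(hder s).deriv]
  have : ‖fderiv ℝ u (γ s) v‖ₑ ≤ ‖fderiv ℝ u (γ s)‖ₑ := by
    rw [← ofReal_norm, ← ofReal_norm]
    exact ENNReal.ofReal_le_ofReal ((fderiv ℝ u (γ s)).unit_le_opNorm v hv)
  dsimp only [Function.comp_apply]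
  gcongr

theorem hasDerivAt_euclideanSpace {ι : Type*} [Fintype ι] {γ : ℝ → EuclideanSpace ℝ ι}
    {v : EuclideanSpace ℝ ι} {s : ℝ} (h : ∀ i, HasDerivAt (fun s => γ s i) (v i) s) :
    HasDerivAt γ v s :=
  ((PiLp.continuousLinearEquiv 2 ℝ (fun _ : ι => ℝ)).symm.hasFDerivAt).comp_hasDerivAt s
    (hasDerivAt_pi.2 h)

theorem measurePreserving_toLp_fin_three :
    MeasurePreserving (fun p : ℝ × ℝ × ℝ => (!₂[p.1, p.2.1, p.2.2] : EuclideanSpace ℝ (Fin 3))) := by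
  have h₁ := (volume_preserving_finTwoArrow ℝ).symm
  have h₂ := (volume_preserving_piFinSuccAbove (fun _ : Fin 3 => ℝ) 0).symm
  have h₃ := PiLp.volume_preserving_toLp (Fin 3)
  have h := h₃.comp (h₂.comp ((MeasurePreserving.id (volume : Measure ℝ)).prod h₁))
  have heq : (fun p : ℝ × ℝ × ℝ => (!₂[p.1, p.2.1, p.2.2] : EuclideanSpace ℝ (Fin 3))) =
      WithLp.toLp 2 ∘ (MeasurableEquiv.piFinSuccAbove (fun _ : Fin 3 => ℝ) 0).symm ∘
        Prod.map id MeasurableEquiv.finTwoArrow.symm := by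
    ext p i
    fin_cases i <;> rfl
  rw [heq]
  exact h

/-- **Ladyzhenskaya's inequality** on `ℝ³`: the `L⁴` norm is controlled by the `H¹` norm. -/
theorem lintegral_enorm_pow_four_le {F : Type*} [NormedAddCommGroup F] [InnerProductSpace ℝ F]
    [FiniteDimensional ℝ F] {u : EuclideanSpace ℝ (Fin 3) → F} (hu : Differentiable ℝ u) :
    ∫⁻ x, ‖u x‖ₑ ^ 4 ≤ 27 * ((∫⁻ x, ‖u x‖ₑ ^ 2) + ∫⁻ x, ‖fderiv ℝ u x‖ₑ ^ 2) ^ 2 := by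
  borelize F
  have huc : Continuous u := hu.continuous
  have hD : Measurable (fderiv ℝ u) := measurable_fderiv ℝ u
  set b : EuclideanSpace ℝ (Fin 3) → ℝ≥0∞ := fun x => ‖u x‖ₑ + 2 * ‖fderiv ℝ u x‖ₑ with hb
  have hmb : Measurable b := by fun_prop
  have hme : Measurable fun x => ‖u x‖ₑ := by fun_prop
  have φ := measurePreserving_toLp_fin_three
  have key : ∫⁻ x, ‖u x‖ₑ ^ 4 ≤ (∫⁻ x, ‖u x‖ₑ * b x) * ∫⁻ x, b x ^ 2 := by
    rw [← φ.lintegral_comp (by fun_prop), ← φ.lintegral_comp (by fun_prop),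
      ← φ.lintegral_comp (by fun_prop)]
    refine lintegral_pow_four_le_of_sq_le_lintegral_line (hme.comp φ.measurable)
      (hmb.comp φ.measurable) (fun z x y => ?_) (fun z x y => ?_) (fun z x y => ?_)
    · refine enorm_sq_le_lintegral_line hu (γ := fun s => !₂[s, x, y])
        (v := EuclideanSpace.single 0 1) (by simp) (fun s => ?_) z
      refine hasDerivAt_euclideanSpace fun i => ?_
      fin_cases i
      · simpa using hasDerivAt_id' s
      · simpa using hasDerivAt_const s x
      · simpa using hasDerivAt_const s y
    · refine enorm_sq_le_lintegral_line hu (γ := fun s => !₂[z, s, y])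
        (v := EuclideanSpace.single 1 1) (by simp) (fun s => ?_) x
      refine hasDerivAt_euclideanSpace fun i => ?_
      fin_cases i
      · simpa using hasDerivAt_const s z
      · simpa using hasDerivAt_id' s
      · simpa using hasDerivAt_const s y
    · refine enorm_sq_le_lintegral_line hu (γ := fun s => !₂[z, x, s])
        (v := EuclideanSpace.single 2 1) (by simp) (fun s => ?_) y
      refine hasDerivAt_euclideanSpace fun i => ?_
      fin_cases i
      · simpa using hasDerivAt_const s z
      · simpa using hasDerivAt_const s x
      · simpa using hasDerivAt_id' s
  have hmax (c d : ℝ≥0∞) : c * (c + 2 * d) ≤ 3 * (c ^ 2 + d ^ 2) ∧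
      (c + 2 * d) ^ 2 ≤ 9 * (c ^ 2 + d ^ 2) := by
    have hm : max c d ^ 2 ≤ c ^ 2 + d ^ 2 := by
      rcases le_total c d with h | h <;> simp [h]
    have h3 : c + 2 * d ≤ 3 * max c d := by
      calc c + 2 * d ≤ max c d + 2 * max c d := by gcongr <;> simp
        _ = 3 * max c d := by ring
    constructor
    · calc c * (c + 2 * d) ≤ max c d * (3 * max c d) := by gcongr; simp
        _ = 3 * max c d ^ 2 := by ring
        _ ≤ _ := by gcongr
    · calc (c + 2 * d) ^ 2 ≤ (3 * max c d) ^ 2 := by gcongr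
        _ = 9 * max c d ^ 2 := by ring
        _ ≤ _ := by gcongr
  have hN : (∫⁻ x, ‖u x‖ₑ ^ 2) + ∫⁻ x, ‖fderiv ℝ u x‖ₑ ^ 2 =
      ∫⁻ x, (‖u x‖ₑ ^ 2 + ‖fderiv ℝ u x‖ₑ ^ 2) := (lintegral_add_left (by fun_prop) _).symm
  rw [hN]
  refine key.trans ?_
  calc (∫⁻ x, ‖u x‖ₑ * b x) * ∫⁻ x, b x ^ 2
      ≤ (∫⁻ x, 3 * (‖u x‖ₑ ^ 2 + ‖fderiv ℝ u x‖ₑ ^ 2)) *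
        ∫⁻ x, 9 * (‖u x‖ₑ ^ 2 + ‖fderiv ℝ u x‖ₑ ^ 2) := by
        exact mul_le_mul' (lintegral_mono fun x => (hmax _ _).1)
          (lintegral_mono fun x => (hmax _ _).2)
    _ = _ := by
        rw [lintegral_const_mul _ (by fun_prop), lintegral_const_mul _ (by fun_prop)]
        ring

theorem MeasureTheory.MemLp.lintegral_enorm_sq {X G : Type*} [MeasurableSpace X] {μ : Measure X}
    [NormedAddCommGroup G] {f : X → G} (hf : MemLp f 2 μ) :
    ∫⁻ x, ‖f x‖ₑ ^ 2 ∂μ = ENNReal.ofReal (∫ x, ‖f x‖ ^ 2 ∂μ) := by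
  rw [ofReal_integral_eq_lintegral_ofReal
    ((memLp_two_iff_integrable_sq_norm hf.aestronglyMeasurable).1 hf)
    (Eventually.of_forall fun x => by positivity)]
  simp_rw [← ofReal_norm, ENNReal.ofReal_pow (norm_nonneg _)]

theorem sum_fderiv_mul_mul_eq_inner
    (L : EuclideanSpace ℝ (Fin 3) →L[ℝ] EuclideanSpace ℝ (Fin 3)) (v : EuclideanSpace ℝ (Fin 3)) :
    ∑ i : Fin 3, ∑ j : Fin 3, L (EuclideanSpace.single i 1) j * v i * v j = inner ℝ (L v) v := by
  have hv : v = ∑ i, v i • EuclideanSpace.single i (1 : ℝ) := by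
    simpa using ((EuclideanSpace.basisFun (Fin 3) ℝ).sum_repr v).symm
  conv_rhs => enter [2]; rw [hv]
  simp only [map_sum, map_smul, sum_inner, inner_smul_left, PiLp.inner_apply, Finset.mul_sum]
  refine Finset.sum_congr rfl fun i _ => Finset.sum_congr rfl fun j _ => ?_
  simp
  ring

/-- The cross term is bounded by the product of `‖∇ū‖_{L²}` and the square of `‖u‖_{H¹}`. -/
theorem sq_integral_cross_term_le {v u : EuclideanSpace ℝ (Fin 3) → EuclideanSpace ℝ (Fin 3)}
    (hu : Differentiable ℝ u) (hu2 : MemLp u 2) (hDu : MemLp (fun x => fderiv ℝ u x) 2)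
    (hDv : MemLp (fun x => fderiv ℝ v x) 2) :
    (∫ x, ∑ i : Fin 3, ∑ j : Fin 3,
        fderiv ℝ v x (EuclideanSpace.single i 1) j * u x i * u x j) ^ 2 ≤
      27 * (∫ x, ‖fderiv ℝ v x‖ ^ 2) *
        ((∫ x, ‖u x‖ ^ 2) + ∫ x, ‖fderiv ℝ u x‖ ^ 2) ^ 2 := by
  simp only [sum_fderiv_mul_mul_eq_inner]
  have huc : Continuous u := hu.continuous
  have hD : Measurable (fderiv ℝ v) := measurable_fderiv ℝ v
  have hpt (x : EuclideanSpace ℝ (Fin 3)) :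
      ‖inner ℝ (fderiv ℝ v x (u x)) (u x)‖ₑ ≤ ‖fderiv ℝ v x‖ₑ * ‖u x‖ₑ ^ 2 := by
    rw [← ofReal_norm, ← ofReal_norm, ← ofReal_norm, ← ENNReal.ofReal_pow (norm_nonneg _),
      ← ENNReal.ofReal_mul (norm_nonneg _)]
    refine ENNReal.ofReal_le_ofReal ((norm_inner_le_norm _ _).trans ?_)
    rw [sq, ← mul_assoc]
    gcongr
    exact (fderiv ℝ v x).le_opNorm _
  have h0 (f : EuclideanSpace ℝ (Fin 3) → ℝ) : 0 ≤ ∫ x, f x ^ 2 :=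
    integral_nonneg fun x => sq_nonneg _
  have h : ‖∫ x, inner ℝ (fderiv ℝ v x (u x)) (u x)‖ₑ ^ 2 ≤
      (∫⁻ x, ‖fderiv ℝ v x‖ₑ ^ 2) *
        (27 * ((∫⁻ x, ‖u x‖ₑ ^ 2) + ∫⁻ x, ‖fderiv ℝ u x‖ₑ ^ 2) ^ 2) := by
    calc ‖∫ x, inner ℝ (fderiv ℝ v x (u x)) (u x)‖ₑ ^ 2
        ≤ (∫⁻ x, ‖fderiv ℝ v x‖ₑ * ‖u x‖ₑ ^ 2) ^ 2 := by
          gcongr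
          exact (MeasureTheory.enorm_integral_le_lintegral_enorm _).trans (lintegral_mono hpt)
      _ ≤ (∫⁻ x, ‖fderiv ℝ v x‖ₑ ^ 2) * ∫⁻ x, (‖u x‖ₑ ^ 2) ^ 2 :=
          sq_lintegral_mul_le _ (by fun_prop) (by fun_prop)
      _ ≤ _ := by
          simp only [← pow_mul]
          gcongr
          exact lintegral_enorm_pow_four_le hu
  rw [hDv.lintegral_enorm_sq, hDu.lintegral_enorm_sq, hu2.lintegral_enorm_sq,
    ← ENNReal.ofReal_add (h0 _) (h0 _), ← ENNReal.ofReal_pow (add_nonneg (h0 _) (h0 _)),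
    ← ofReal_norm, ← ENNReal.ofReal_pow (norm_nonneg _), ← ENNReal.ofReal_ofNat 27,
    ← ENNReal.ofReal_mul (by norm_num), ← ENNReal.ofReal_mul (h0 _),
    ENNReal.ofReal_le_ofReal_iff (mul_nonneg (h0 _) (by positivity)), Real.norm_eq_abs,
    sq_abs] at h
  linarith

/-- **Decay of the cross term.**
If `‖ū(t)‖²_{H¹_α} ≤ C (C'+t)^{-(3/2+r*)}` and
`‖u(t)‖²_{H¹_α} ≤ C (C'+t)^{-min{3/2+r*, 5/2}}` for `t > 0`, with `r* ∈ (-3/2, ∞)`, then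
`|∫ Σ_{i,j} (∂ᵢūⱼ) uᵢ uⱼ dx| ≤ C₁ (C₂+t)^{-min{9/4 + (3/2)r*, 13/4 + (1/2)r*}}`.
Here `‖v‖²_{H¹_α} = ∫‖v‖² + α²∫‖∇v‖²` and `H¹` membership is encoded by
differentiability together with square-integrability of the field and its gradient. -/
theorem cross_term_decay
    (α rstar : ℝ) (hα : 0 < α) (hr : -(3:ℝ)/2 < rstar)
    (ubar u : ℝ → EuclideanSpace ℝ (Fin 3) → EuclideanSpace ℝ (Fin 3))
    (C C' : ℝ) (hC : 0 < C) (hC' : 0 < C')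
    (hdiffu : ∀ t > (0:ℝ), Differentiable ℝ (u t))
    (hdiffubar : ∀ t > (0:ℝ), Differentiable ℝ (ubar t))
    (huL2 : ∀ t > (0:ℝ), MemLp (u t) 2 volume)
    (huH1 : ∀ t > (0:ℝ), MemLp (fun x => fderiv ℝ (u t) x) 2 volume)
    (hubarL2 : ∀ t > (0:ℝ), MemLp (ubar t) 2 volume)
    (hubarH1 : ∀ t > (0:ℝ), MemLp (fun x => fderiv ℝ (ubar t) x) 2 volume)
    (hubar_decay : ∀ t > (0:ℝ),
      (∫ x : EuclideanSpace ℝ (Fin 3), ‖ubar t x‖ ^ 2)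
          + α ^ 2 * ∫ x : EuclideanSpace ℝ (Fin 3), ‖fderiv ℝ (ubar t) x‖ ^ 2
        ≤ C * (C' + t) ^ (-(3/2 + rstar)))
    (hu_decay : ∀ t > (0:ℝ),
      (∫ x : EuclideanSpace ℝ (Fin 3), ‖u t x‖ ^ 2)
          + α ^ 2 * ∫ x : EuclideanSpace ℝ (Fin 3), ‖fderiv ℝ (u t) x‖ ^ 2
        ≤ C * (C' + t) ^ (-(min (3/2 + rstar) (5/2)))) :
    ∃ C₁ > (0:ℝ), ∃ C₂ > (0:ℝ), ∀ t > (0:ℝ),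
      |∫ x : EuclideanSpace ℝ (Fin 3),
          ∑ i : Fin 3, ∑ j : Fin 3,
            fderiv ℝ (ubar t) x (EuclideanSpace.single i 1) j * u t x i * u t x j|
        ≤ C₁ * (C₂ + t) ^ (-(min (9/4 + 3/2 * rstar) (13/4 + 1/2 * rstar))) := by
  set K : ℝ := 27 * (α⁻¹ ^ 2 * C) * ((1 + α⁻¹ ^ 2) * C) ^ 2 with hK
  have hKpos : 0 < K := by positivity
  refine ⟨√K, Real.sqrt_pos.2 hKpos, C', hC', fun t ht => ?_⟩
  have hτ : 0 < C' + t := by positivity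
  have hα2 : α⁻¹ ^ 2 * α ^ 2 = 1 := by field_simp
  have h0 (f : EuclideanSpace ℝ (Fin 3) → ℝ) : 0 ≤ ∫ x, f x ^ 2 :=
    integral_nonneg fun x => sq_nonneg _
  have hP : ∫ x, ‖fderiv ℝ (ubar t) x‖ ^ 2 ≤ α⁻¹ ^ 2 * C * (C' + t) ^ (-(3/2 + rstar)) := by
    calc ∫ x, ‖fderiv ℝ (ubar t) x‖ ^ 2
        = α⁻¹ ^ 2 * (α ^ 2 * ∫ x, ‖fderiv ℝ (ubar t) x‖ ^ 2) := by rw [← mul_assoc, hα2, one_mul]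
      _ ≤ α⁻¹ ^ 2 * (C * (C' + t) ^ (-(3/2 + rstar))) := by
          have := h0 fun x => ‖ubar t x‖
          refine mul_le_mul_of_nonneg_left ?_ (by positivity)
          linarith [hubar_decay t ht]
      _ = _ := by ring
  set m := min (3/2 + rstar) (5/2) with hm
  have hN : (∫ x, ‖u t x‖ ^ 2) + ∫ x, ‖fderiv ℝ (u t) x‖ ^ 2 ≤
      (1 + α⁻¹ ^ 2) * C * (C' + t) ^ (-m) := by
    have ha := h0 fun x => ‖u t x‖
    have hb := h0 fun x => ‖fderiv ℝ (u t) x‖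
    calc (∫ x, ‖u t x‖ ^ 2) + ∫ x, ‖fderiv ℝ (u t) x‖ ^ 2
        = (∫ x, ‖u t x‖ ^ 2) + α⁻¹ ^ 2 * (α ^ 2 * ∫ x, ‖fderiv ℝ (u t) x‖ ^ 2) := by
          rw [← mul_assoc, hα2, one_mul]
      _ ≤ (1 + α⁻¹ ^ 2) * ((∫ x, ‖u t x‖ ^ 2) + α ^ 2 * ∫ x, ‖fderiv ℝ (u t) x‖ ^ 2) := by
          have := mul_nonneg (sq_nonneg α⁻¹) ha
          have := mul_nonneg (sq_nonneg α) hb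
          linarith
      _ ≤ (1 + α⁻¹ ^ 2) * (C * (C' + t) ^ (-m)) := by
          exact mul_le_mul_of_nonneg_left (hu_decay t ht) (by positivity)
      _ = _ := by ring
  set M := min (9/4 + 3/2 * rstar) (13/4 + 1/2 * rstar) with hM
  have hexp : -(3/2 + rstar) + -m + -m = -M + -M := by
    rw [hm, hM]
    rcases le_total (3/2 + rstar) (5/2) with h | h
    · rw [min_eq_left h, min_eq_left (by linarith)]; ring
    · rw [min_eq_right h, min_eq_right (by linarith)]; ring
  refine abs_le_of_sq_le_sq ?_ (by positivity)
  calc _ ≤ 27 * (∫ x, ‖fderiv ℝ (ubar t) x‖ ^ 2) *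
        ((∫ x, ‖u t x‖ ^ 2) + ∫ x, ‖fderiv ℝ (u t) x‖ ^ 2) ^ 2 :=
        sq_integral_cross_term_le (hdiffu t ht) (huL2 t ht) (huH1 t ht) (hubarH1 t ht)
    _ ≤ 27 * (α⁻¹ ^ 2 * C * (C' + t) ^ (-(3/2 + rstar))) *
        ((1 + α⁻¹ ^ 2) * C * (C' + t) ^ (-m)) ^ 2 := by
        have := h0 fun x => ‖u t x‖
        have := h0 fun x => ‖fderiv ℝ (u t) x‖
        gcongr
    _ = K * ((C' + t) ^ (-(3/2 + rstar)) * (C' + t) ^ (-m) * (C' + t) ^ (-m)) := by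
        rw [hK]; ring
    _ = K * ((C' + t) ^ (-M) * (C' + t) ^ (-M)) := by
        rw [← Real.rpow_add hτ, ← Real.rpow_add hτ, ← Real.rpow_add hτ, hexp]
    _ = (√K * (C' + t) ^ (-M)) ^ 2 := by
        rw [mul_pow, Real.sq_sqrt hKpos.le, sq]
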